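/- Let (R, m) be a commutative Noetherian local ring in which every parameter ideal is irreducible. Then R is a Gorenstein ring. -/

import Mathlib

open IsLocalRing

/-- A parameter ideal of a Noetherian local ring: an ideal generated by a system of
parameters, i.e. by `d` elements of the maximal ideal (where `d` is the Krull dimension
of the ring) generating an ideal whose radical is the maximal ideal. -/
def IsParameterIdeal (R : Type*) [CommRing R] [IsLocalRing R] (I : Ideal R) : Prop :=
  ∃ (d : ℕ) (a : Fin d → R), ringKrullDim R = d ∧ (∀ i, a i ∈ maximalIdeal R) ∧
    I = Ideal.span (Set.range a) ∧ I.radical = maximalIdeal R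

/-- A ring is Gorenstein if it has finite injective dimension as a module over itself,
i.e. it admits an injective resolution vanishing in all sufficiently large degrees. -/
def HasFiniteInjectiveDimension (R : Type*) [CommRing R] : Prop :=
  ∃ (n : ℕ) (J : CategoryTheory.InjectiveResolution (ModuleCat.of R R)),
    ∀ i, n < i → CategoryTheory.Limits.IsZero (J.cocomplex.X i)

/-- An ideal is irreducible if it is proper and whenever it is the intersection of two
ideals it equals one of them. -/
def IsIrreducibleIdeal {R : Type*} [CommRing R] (I : Ideal R) : Prop :=
  I ≠ ⊤ ∧ ∀ J K : Ideal R, I = J ⊓ K → I = J ∨ I = K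

universe v u

section InjectiveDimension

open CategoryTheory Limits Abelian

/-- An object of injective dimension at most `n` has an injective resolution of length at most `n`. -/
theorem CategoryTheory.exists_injectiveResolution_isZero_of_hasInjectiveDimensionLE
    {C : Type u} [Category.{v} C] [Abelian C] [EnoughInjectives C] (n : ℕ) (Z : C)
    [hZ : HasInjectiveDimensionLE Z n] :
    ∃ J : InjectiveResolution Z, ∀ i, n < i → IsZero (J.cocomplex.X i) := by
  induction n generalizing Z with
  | zero =>
    have : Injective Z := injective_iff_hasInjectiveDimensionLT_one.mpr hZ
    refine ⟨InjectiveResolution.self Z, fun i hi ↦ ?_⟩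
    exact HomologicalComplex.isZero_single_obj_X _ _ _ _ hi.ne'
  | succ n ih =>
    obtain ⟨⟨I, hI, f, hf⟩⟩ := EnoughInjectives.presentation Z
    let S := ShortComplex.mk f (cokernel.π f) (cokernel.condition f)
    have hS : S.ShortExact := { exact := ShortComplex.exact_cokernel f }
    have : HasInjectiveDimensionLE (cokernel f) n :=
      (hS.hasInjectiveDimensionLT_X₃_iff n hI).mpr hZ
    obtain ⟨K, hK⟩ := ih (cokernel f)
    let k : cokernel f ⟶ K.cocomplex.X 0 := K.ι.f 0
    have hk : k ≫ K.cocomplex.d 0 1 = 0 := K.ι_f_zero_comp_complex_d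
    have : Mono k := inferInstanceAs (Mono (K.ι.f 0))
    have hkexact : (ShortComplex.mk k (K.cocomplex.d 0 1) hk).Exact :=
      ShortComplex.exact_of_f_is_kernel _ K.isLimitKernelFork
    let g : I ⟶ K.cocomplex.X 0 := cokernel.π f ≫ k
    have hg : g ≫ K.cocomplex.d 0 1 = 0 := by simp only [g, Category.assoc, hk, comp_zero]
    have hfg : f ≫ g = 0 := by simp [g]
    have hfgexact : (ShortComplex.mk f g hfg).Exact := by
      let φ : S ⟶ ShortComplex.mk f g hfg := { τ₁ := 𝟙 _, τ₂ := 𝟙 _, τ₃ := k }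
      have : Epi φ.τ₁ := inferInstanceAs (Epi (𝟙 _))
      have : IsIso φ.τ₂ := inferInstanceAs (IsIso (𝟙 _))
      have : Mono φ.τ₃ := inferInstanceAs (Mono k)
      exact (ShortComplex.exact_iff_of_epi_of_isIso_of_mono φ).mp hS.exact
    have hgexact : (ShortComplex.mk g (K.cocomplex.d 0 1) hg).Exact := by
      let φ : ShortComplex.mk g (K.cocomplex.d 0 1) hg ⟶
          ShortComplex.mk k (K.cocomplex.d 0 1) hk :=
        { τ₁ := cokernel.π f, τ₂ := 𝟙 _, τ₃ := 𝟙 _ }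
      have : Epi φ.τ₁ := inferInstanceAs (Epi (cokernel.π f))
      have : IsIso φ.τ₂ := inferInstanceAs (IsIso (𝟙 _))
      have : Mono φ.τ₃ := inferInstanceAs (Mono (𝟙 _))
      exact (ShortComplex.exact_iff_of_epi_of_isIso_of_mono φ).mpr hkexact
    let A := CochainComplex.augment K.cocomplex g hg
    have hA (i : ℕ) : Injective (A.X i) :=
      match i with
      | 0 => hI
      | i + 1 => K.injective i
    have hAexact (i : ℕ) : A.ExactAt (i + 1) := by
      rw [HomologicalComplex.exactAt_iff' _ i (i + 1) (i + 1 + 1) (by simp) (by simp)]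
      match i with
      | 0 => exact hgexact
      | i + 1 => exact K.exact_succ i
    have hι : ((CochainComplex.fromSingle₀Equiv A Z).symm ⟨f, hfg⟩).f 0 ≫ 𝟙 (A.X 0) = f := by
      rw [Category.comp_id]
      exact CochainComplex.fromSingle₀Equiv_symm_apply_f_zero (C := A) f hfg
    refine ⟨{
      cocomplex := A
      injective := hA
      ι := (CochainComplex.fromSingle₀Equiv _ _).symm ⟨f, hfg⟩
      quasiIso := ⟨fun i ↦ ?_⟩ }, fun i hi ↦ ?_⟩
    · cases i with
      | zero =>
        rw [CochainComplex.quasiIsoAt₀_iff, ShortComplex.quasiIso_iff_of_zeros]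
        · refine (ShortComplex.exact_and_mono_f_iff_of_iso ?_).2 ⟨hfgexact, hf⟩
          exact ShortComplex.isoMk (Iso.refl _) (Iso.refl _) (Iso.refl _)
            ((Category.id_comp f).trans hι.symm)
            ((Category.id_comp g).trans (Category.comp_id g).symm)
        all_goals rfl
      | succ i =>
        rw [quasiIsoAt_iff_exactAt]
        · exact hAexact i
        · apply CochainComplex.exactAt_succ_single_obj
    · match i with
      | i + 1 => exact hK i (by omega)

theorem Module.Injective.smul_surjective {R : Type u} [CommRing R] (M : Type u) [AddCommGroup M]
    [Module R M] [Module.Injective R M] {x : R} (hx : IsSMulRegular R x) :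
    Function.Surjective (LinearMap.lsmul R M x) := by
  intro m
  obtain ⟨h, hh⟩ := Module.Injective.out (LinearMap.lsmul R R x) hx
    (LinearMap.toSpanSingleton R M m)
  refine ⟨h 1, ?_⟩
  have := hh 1
  simp only [LinearMap.lsmul_apply, LinearMap.toSpanSingleton_apply, one_smul] at this ⊢
  rw [← map_smul, this]

theorem ModuleCat.hasInjectiveDimensionLE_torsionBy {R : Type u} [CommRing R]
    {x : R} (hx : IsSMulRegular R x) (M : Type u) [AddCommGroup M] [Module R M]
    [Module.Injective R M] :
    HasInjectiveDimensionLE (ModuleCat.of R (Submodule.torsionBy R M x)) 1 := by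
  have hexact : Function.Exact (Submodule.torsionBy R M x).subtype (LinearMap.lsmul R M x) := by
    intro m
    simp [Submodule.mem_torsionBy_iff]
  have surj := Module.Injective.smul_surjective M hx
  let S : ShortComplex (ModuleCat.{u} R) :=
    ModuleCat.shortComplexOfCompEqZero _ _ hexact.linearMap_comp_eq_zero
  have hS : S.ShortExact := ModuleCat.shortComplex_shortExact S hexact
    (Submodule.subtype_injective _) surj
  have : Injective (ModuleCat.of R M) := Module.injective_object_of_injective_module R M
  exact (hS.hasInjectiveDimensionLT_X₃_iff 0 this).mp
    (inferInstanceAs (HasInjectiveDimensionLT (ModuleCat.of R M) 1))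

theorem ModuleCat.hasInjectiveDimensionLE_one_restrictScalars_of_injective {R : Type u} [CommRing R]
    {x : R} (hx : IsSMulRegular R x) (E : ModuleCat.{u} (R ⧸ Ideal.span {x})) [Injective E] :
    HasInjectiveDimensionLE
      ((ModuleCat.restrictScalars (Ideal.Quotient.mk (Ideal.span {x}))).obj E) 1 := by
  let F := ModuleCat.restrictScalars (Ideal.Quotient.mk (Ideal.span {x}))
  obtain ⟨⟨M, hM, f, hf⟩⟩ := EnoughInjectives.presentation (F.obj E)
  have : Module.Injective R M := Module.injective_module_of_injective_object R M
  have : Module.Injective (R ⧸ Ideal.span {x}) E :=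
    Module.injective_module_of_injective_object _ E
  let T := Submodule.torsionBy R M x
  have hfT (e : F.obj E) : f.hom e ∈ T := by
    rw [Submodule.mem_torsionBy_iff, ← map_smul, ModuleCat.restrictScalars.smul_def,
      Ideal.Quotient.eq_zero_iff_mem.mpr (Ideal.mem_span_singleton_self x)]
    exact (congrArg f.hom (zero_smul _ (e : E))).trans (map_zero _)
  let f' : F.obj E →ₗ[R] T := f.hom.codRestrict T hfT
  let : Module (R ⧸ Ideal.span {x}) T :=
    inferInstanceAs (Module (R ⧸ R ∙ x) (Submodule.torsionBy R M x))
  let g : E →ₗ[R ⧸ Ideal.span {x}] T :=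
    { toFun := f'
      map_add' := f'.map_add
      map_smul' := fun r e ↦ by
        obtain ⟨r, rfl⟩ := Ideal.Quotient.mk_surjective r
        exact f'.map_smul r e }
  have hg : Function.Injective g := fun a b hab ↦
    (ModuleCat.mono_iff_injective f).mp hf congr(($hab : M))
  obtain ⟨h, hh⟩ := Module.Injective.out g hg LinearMap.id
  let h' : T →ₗ[R] F.obj E :=
    { toFun := h
      map_add' := h.map_add
      map_smul' := fun r t ↦ h.map_smul (Ideal.Quotient.mk _ r) t }
  have := ModuleCat.hasInjectiveDimensionLE_torsionBy hx M
  exact Retract.hasInjectiveDimensionLT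
    { i := ModuleCat.ofHom f', r := ModuleCat.ofHom h', retract := by ext e; exact hh e } 2

/-- Restriction of scalars along `R → R ⧸ (x)`, with `x` regular, raises the injective dimension by
at most one. -/
theorem ModuleCat.hasInjectiveDimensionLE_restrictScalars {R : Type u} [CommRing R]
    {x : R} (hx : IsSMulRegular R x) (n : ℕ) (E : ModuleCat.{u} (R ⧸ Ideal.span {x}))
    [hE : HasInjectiveDimensionLE E n] :
    HasInjectiveDimensionLE
      ((ModuleCat.restrictScalars (Ideal.Quotient.mk (Ideal.span {x}))).obj E) (n + 1) := by
  induction n generalizing E with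
  | zero =>
    have : Injective E := injective_iff_hasInjectiveDimensionLT_one.mpr hE
    exact ModuleCat.hasInjectiveDimensionLE_one_restrictScalars_of_injective hx E
  | succ n ih =>
    obtain ⟨⟨I, hI, f, hf⟩⟩ := EnoughInjectives.presentation E
    let S := ShortComplex.mk f (cokernel.π f) (cokernel.condition f)
    have hS : S.ShortExact := { exact := ShortComplex.exact_cokernel f }
    have : HasInjectiveDimensionLE (cokernel f) n :=
      (hS.hasInjectiveDimensionLT_X₃_iff n hI).mpr hE
    have := ModuleCat.hasInjectiveDimensionLE_one_restrictScalars_of_injective hx I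
    refine (hS.map_of_exact (ModuleCat.restrictScalars
      (Ideal.Quotient.mk (Ideal.span {x})))).hasInjectiveDimensionLT_X₁ (n + 2)
      (ih (cokernel f)) ?_
    exact hasInjectiveDimensionLT_of_ge ((ModuleCat.restrictScalars
      (Ideal.Quotient.mk (Ideal.span {x}))).obj I) 2 _ (by omega)

/-- Injective dimension is detected by `Ext` from cyclic modules. -/
theorem ModuleCat.hasInjectiveDimensionLT_of_forall_ideal {R : Type u} [CommRing R] (n : ℕ)
    (M : ModuleCat.{u} R)
    (h : ∀ I : Ideal R, Subsingleton (Ext (ModuleCat.of R (R ⧸ I)) M (n + 1))) :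
    HasInjectiveDimensionLT M (n + 1) := by
  induction n generalizing M with
  | zero =>
    rw [← injective_iff_hasInjectiveDimensionLT_one, ← Module.injective_iff_injective_object,
      ← Module.Baer.iff_injective]
    intro I g
    let S : ShortComplex (ModuleCat.{u} R) :=
      ModuleCat.shortComplexOfCompEqZero I.subtype I.mkQ
        (LinearMap.exact_subtype_mkQ I).linearMap_comp_eq_zero
    have hS : S.ShortExact := ModuleCat.shortComplex_shortExact S
      (LinearMap.exact_subtype_mkQ I) I.subtype_injective I.mkQ_surjective
    obtain ⟨φ, hφ⟩ := Ext.contravariant_sequence_exact₁ hS M (Ext.mk₀ (ModuleCat.ofHom g))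
      (zero_add 1) ((h I).elim _ _)
    obtain ⟨φ, rfl⟩ := (Ext.mk₀_bijective S.X₂ M).2 φ
    rw [Ext.mk₀_comp_mk₀, (Ext.mk₀_bijective _ _).1.eq_iff] at hφ
    exact ⟨φ.hom, fun y hy ↦ congr($(hφ).hom ⟨y, hy⟩)⟩
  | succ n ih =>
    obtain ⟨⟨I, hI, f, hf⟩⟩ := EnoughInjectives.presentation M
    let S := ShortComplex.mk f (cokernel.π f) (cokernel.condition f)
    have hS : S.ShortExact := { exact := ShortComplex.exact_cokernel f }
    rw [← hS.hasInjectiveDimensionLT_X₃_iff n hI]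
    refine ih _ fun J ↦ ⟨fun a b ↦ ?_⟩
    rw [← sub_eq_zero]
    obtain ⟨c, hc⟩ := Ext.covariant_sequence_exact₃ _ hS (a - b) rfl ((h J).elim _ _)
    rw [← hc, c.eq_zero_of_hasInjectiveDimensionLT 1 (by omega), Ext.zero_comp]

theorem ModuleCat.hasInjectiveDimensionLE_of_quotSMulTop {R : Type u} [CommRing R]
    [IsLocalRing R] [IsNoetherianRing R] (M : ModuleCat.{u} R) [Module.Finite R M] (x : R)
    (reg : IsSMulRegular M x) (mem : x ∈ maximalIdeal R)
    (n : ℕ) [h : HasInjectiveDimensionLE (ModuleCat.of R (QuotSMulTop x M)) n] :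
    HasInjectiveDimensionLE M n := by
  apply ModuleCat.hasInjectiveDimensionLT_of_forall_ideal
  intro I
  let L := ModuleCat.of R (R ⧸ I)
  let S := M.smulShortComplex x
  have hS : S.ShortExact := reg.smulShortComplex_shortExact
  have zero := HasInjectiveDimensionLT.subsingleton (ModuleCat.of R (QuotSMulTop x M))
    (n + 1) _ le_rfl L
  have epi (y : Ext L M (n + 1)) : ∃ z : Ext L M (n + 1), x • z = y := by
    obtain ⟨z, hz⟩ := Ext.covariant_sequence_exact₂ L hS y (zero.elim _ _)
    change Ext L M (n + 1) at z
    change z.comp (Ext.mk₀ (x • 𝟙 M)) (add_zero (n + 1)) = y at hz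
    exact ⟨z, by rw [← hz, Ext.mk₀_smul, Ext.comp_smul, Ext.comp_mk₀_id]⟩
  by_contra! ntr
  have : x ∈ (Module.annihilator R (Ext L M (n + 1))).jacobson :=
    (IsLocalRing.maximalIdeal_le_jacobson _) mem
  absurd Submodule.top_ne_pointwise_smul_of_mem_jacobson_annihilator this
  rw [eq_comm, eq_top_iff]
  intro y hy
  rcases epi y with ⟨z, rfl⟩
  exact Submodule.smul_mem_pointwise_smul _ _ ⊤ trivial

open scoped Pointwise in
theorem ModuleCat.hasInjectiveDimensionLE_of_quotient_span_singleton {R : Type u} [CommRing R]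
    [IsLocalRing R] [IsNoetherianRing R] {x : R} (hx : IsSMulRegular R x)
    (mem : x ∈ IsLocalRing.maximalIdeal R) (n : ℕ)
    [HasInjectiveDimensionLE (ModuleCat.of (R ⧸ Ideal.span {x}) (R ⧸ Ideal.span {x})) n] :
    HasInjectiveDimensionLE (ModuleCat.of R R) (n + 1) := by
  have := ModuleCat.hasInjectiveDimensionLE_restrictScalars hx n
    (ModuleCat.of (R ⧸ Ideal.span {x}) (R ⧸ Ideal.span {x}))
  have h : Ideal.span {x} = x • (⊤ : Ideal R) := by
    simp [← Submodule.ideal_span_singleton_smul]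
  let e : (ModuleCat.restrictScalars (Ideal.Quotient.mk (Ideal.span {x}))).obj
      (ModuleCat.of (R ⧸ Ideal.span {x}) (R ⧸ Ideal.span {x})) ≃ₗ[R] QuotSMulTop x R :=
    Submodule.quotEquivOfEq _ _ h
  have : HasInjectiveDimensionLE (ModuleCat.of R (QuotSMulTop x (ModuleCat.of R R))) (n + 1) :=
    hasInjectiveDimensionLT_of_iso e.toModuleIso _
  exact ModuleCat.hasInjectiveDimensionLE_of_quotSMulTop (ModuleCat.of R R) x hx mem (n + 1)

end InjectiveDimension

theorem Module.length_dual_eq_add {R : Type*} [CommRing R] {M : Type*} [AddCommGroup M] [Module R M]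
    (N : Submodule R M) :
    Module.length R (Module.Dual R M) = Module.length R (Module.Dual R (M ⧸ N)) +
      Module.length R (LinearMap.range (LinearMap.lcomp R R N.subtype)) := by
  refine Module.length_eq_add_of_exact (LinearMap.lcomp R R N.mkQ)
    (LinearMap.lcomp R R N.subtype).rangeRestrict
    (LinearMap.lcomp_injective_of_surjective _ N.mkQ_surjective)
    (LinearMap.surjective_rangeRestrict _) ?_
  intro φ
  constructor
  · intro h
    have hφ : N ≤ LinearMap.ker φ := fun n hn ↦ congr($(congrArg Subtype.val h) ⟨n, hn⟩)
    exact ⟨N.liftQ φ hφ, N.liftQ_mkQ φ hφ⟩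
  · rintro ⟨ψ, rfl⟩
    ext n
    simp [(Submodule.Quotient.mk_eq_zero N).mpr n.2]

theorem IsIrreducibleIdeal.exists_mul_eq_of_bot {R : Type*} [CommRing R] [IsLocalRing R]
    (h : IsIrreducibleIdeal (⊥ : Ideal R)) {a b : R}
    (hb : ∀ r ∈ maximalIdeal R, r * b = 0) (ha0 : a ≠ 0) : ∃ r, r * a = b := by
  by_cases hb0 : b = 0
  · exact ⟨0, by simp [hb0]⟩
  obtain ⟨c, ⟨hca, hcb⟩, hc⟩ : ∃ c ∈ Ideal.span {a} ⊓ Ideal.span {b}, c ≠ 0 := by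
    by_contra! hab
    rcases h.2 _ _ ((Submodule.eq_bot_iff _).mpr hab).symm with h | h
    · exact ha0 (Ideal.span_singleton_eq_bot.mp h.symm)
    · exact hb0 (Ideal.span_singleton_eq_bot.mp h.symm)
  obtain ⟨r, rfl⟩ := Ideal.mem_span_singleton'.mp hca
  obtain ⟨s, hs⟩ := Ideal.mem_span_singleton'.mp hcb
  have hu : IsUnit s := by
    by_contra hs'
    exact hc (by rw [← hs, hb s hs'])
  obtain ⟨t, ht⟩ := hu.exists_left_inv
  exact ⟨t * r, by rw [mul_assoc, ← hs, ← mul_assoc, ht, one_mul]⟩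

theorem IsIrreducibleIdeal.length_dual_le_one {R : Type*} [CommRing R] [IsLocalRing R]
    (h : IsIrreducibleIdeal (⊥ : Ideal R)) (S : Type*) [AddCommGroup S] [Module R S]
    [IsSimpleModule R S] : Module.length R (Module.Dual R S) ≤ 1 := by
  have := IsSimpleModule.nontrivial R S
  obtain ⟨s, hs⟩ := exists_ne (0 : S)
  have hspan := IsSimpleModule.toSpanSingleton_surjective R hs
  have hann (r) (hr : r ∈ maximalIdeal R) : r • s = 0 := by
    have := (IsSimpleModule.annihilator_isMaximal : (Module.annihilator R S).IsMaximal)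
    rw [← IsLocalRing.eq_maximalIdeal this] at hr
    exact Module.mem_annihilator.mp hr s
  have hsoc (f : Module.Dual R S) (r) (hr : r ∈ maximalIdeal R) : r * f s = 0 := by
    rw [← smul_eq_mul, ← map_smul, hann r hr, map_zero]
  have hext {f g : Module.Dual R S} (hfg : f s = g s) : f = g := by
    ext t
    obtain ⟨r, rfl⟩ := hspan t
    simp [hfg]
  cases subsingleton_or_nontrivial (Module.Dual R S)
  · simp
  · have : IsSimpleModule R (Module.Dual R S) := by
      rw [isSimpleModule_iff_toSpanSingleton_surjective]
      refine ⟨inferInstance, fun f hf g ↦ ?_⟩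
      obtain ⟨r, hr⟩ := h.exists_mul_eq_of_bot (hsoc g)
        fun h0 ↦ hf (hext (by simpa using h0))
      exact ⟨r, hext (by simpa using hr)⟩
    rw [Module.length_eq_one]

theorem IsIrreducibleIdeal.length_dual_le {R : Type*} [CommRing R] [IsLocalRing R]
    (h : IsIrreducibleIdeal (⊥ : Ideal R)) {M : Type*} [AddCommGroup M] [Module R M]
    (hM : IsFiniteLength R M) : Module.length R (Module.Dual R M) ≤ Module.length R M := by
  induction hM with
  | of_subsingleton => simp
  | @of_simple_quotient M _ _ N _ hN ih =>
    rw [Module.length_dual_eq_add N, Module.length_eq_add_of_exact N.subtype N.mkQ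
      N.subtype_injective N.mkQ_surjective (LinearMap.exact_subtype_mkQ N), add_comm,
      Module.length_eq_one R (M ⧸ N)]
    exact add_le_add ((Module.length_le_of_injective _ (Submodule.subtype_injective _)).trans ih)
      (h.length_dual_le_one _)

/-- An Artinian local ring whose zero ideal is irreducible is self-injective. -/
theorem IsIrreducibleIdeal.injective_self {R : Type u} [CommRing R] [IsLocalRing R]
    [IsArtinianRing R] (h : IsIrreducibleIdeal (⊥ : Ideal R)) : Module.Injective R R := by
  rw [← Module.Baer.iff_injective, Module.Baer.iff_surjective]
  intro I
  have fin (M : Type u) [AddCommGroup M] [Module R M] [Module.Finite R M] : IsFiniteLength R M :=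
    isFiniteLength_iff_isNoetherian_isArtinian.mpr ⟨inferInstance, inferInstance⟩
  rw [← LinearMap.range_eq_top]
  by_contra hne
  have hlt := Submodule.length_lt hne
  have hdual := Module.length_dual_eq_add I
  have hself := Module.length_eq_add_of_exact I.subtype I.mkQ
      I.subtype_injective I.mkQ_surjective (LinearMap.exact_subtype_mkQ I)
  rw [(LinearMap.ringLmapEquivSelf R R R).length_eq, hself, add_comm] at hdual
  have h1 := h.length_dual_le (fin I)
  have h2 := h.length_dual_le (fin (R ⧸ I))
  have h3 : Module.length R (R ⧸ I) ≠ ⊤ := Module.length_ne_top_iff.mpr (fin _)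
  have := (hdual.le.trans (add_le_add_left h2 _))
  have := (ENat.add_le_add_iff_left h3).mp this
  exact (hlt.trans_le h1).not_ge this

open Ideal in
theorem ringKrullDim_quotient_span_singleton_succ_eq_of_notMem_minimalPrimes {R : Type*}
    [CommRing R] [IsNoetherianRing R] [IsLocalRing R] {x : R} (hn : ∀ p ∈ minimalPrimes R, x ∉ p)
    (hx : x ∈ maximalIdeal R) : ringKrullDim (R ⧸ span {x}) + 1 = ringKrullDim R := by
  have hann : Module.annihilator R R = ⊥ := Module.annihilator_eq_bot.mpr inferInstance
  have := Module.supportDim_quotSMulTop_succ_eq_of_notMem_minimalPrimes_of_mem_maximalIdeal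
    (M := R) (by rwa [hann]) hx
  rw [← Module.supportDim_self_eq_ringKrullDim R, ← this, ← Module.supportDim_quotient_eq_ringKrullDim]
  congr 1
  refine Module.supportDim_eq_of_equiv (Submodule.quotEquivOfEq _ _ ?_)
  simp [← Submodule.ideal_span_singleton_smul]

theorem IsIrreducibleIdeal.of_comap {R S : Type*} [CommRing R] [CommRing S] {f : R →+* S}
    (hf : Function.Surjective f) {I : Ideal S} (h : IsIrreducibleIdeal (I.comap f)) :
    IsIrreducibleIdeal I := by
  refine ⟨fun hI ↦ h.1 (by rw [hI, Ideal.comap_top]), ?_⟩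
  rintro J K rfl
  exact (h.2 _ _ (Ideal.comap_inf ..)).imp
    (fun e ↦ Ideal.comap_injective_of_surjective f hf e)
    (fun e ↦ Ideal.comap_injective_of_surjective f hf e)

theorem IsParameterIdeal.comap {R S : Type*} [CommRing R] [IsLocalRing R] [CommRing S]
    [IsLocalRing S] {f : R →+* S} (hf : Function.Surjective f) {x : R}
    (hx : x ∈ maximalIdeal R) (hker : RingHom.ker f = Ideal.span {x})
    (hdim : ringKrullDim S + 1 = ringKrullDim R) {I : Ideal S} (hI : IsParameterIdeal S I) :
    IsParameterIdeal R (I.comap f) := by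
  obtain ⟨d, a, hd, ha, rfl, hrad⟩ := hI
  have hloc := IsLocalHom.of_surjective f hf
  choose b hb using fun i ↦ hf (a i)
  refine ⟨d + 1, Fin.cons x b, by simp [← hdim, hd], ?_, ?_, ?_⟩
  · refine Fin.cases hx fun i ↦ ?_
    have := ha i
    rwa [← hb, ← Ideal.mem_comap, IsLocalRing.maximalIdeal_comap] at this
  · have hab : Ideal.span (Set.range a) = (Ideal.span (Set.range b)).map f := by
      rw [Ideal.map_span, ← Set.range_comp]
      congr
      exact (funext hb).symm
    rw [hab, Ideal.comap_map_of_surjective f hf, ← RingHom.ker_eq_comap_bot, hker, Fin.range_cons,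
      Set.insert_eq, Ideal.span_union, sup_comm]
  · rw [← Ideal.comap_radical, hrad, IsLocalRing.maximalIdeal_comap]

/-- The condition that every parameter ideal is irreducible. -/
def ParameterIdealsIrreducible (R : Type*) [CommRing R] [IsLocalRing R] : Prop :=
  ∀ I : Ideal R, IsParameterIdeal R I → IsIrreducibleIdeal I

theorem ParameterIdealsIrreducible.of_surjective {R S : Type*} [CommRing R] [IsLocalRing R]
    [CommRing S] [IsLocalRing S] (h : ParameterIdealsIrreducible R) {f : R →+* S}
    (hf : Function.Surjective f) {x : R} (hx : x ∈ maximalIdeal R)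
    (hker : RingHom.ker f = Ideal.span {x}) (hdim : ringKrullDim S + 1 = ringKrullDim R) :
    ParameterIdealsIrreducible S :=
  fun _ hI ↦ .of_comap hf (h _ (hI.comap hf hx hker hdim))

theorem IsLocalRing.isLocalRing_quotient_span_singleton {R : Type*} [CommRing R] [IsLocalRing R]
    {x : R} (hx : x ∈ maximalIdeal R) : IsLocalRing (R ⧸ Ideal.span {x}) :=
  have : Nontrivial (R ⧸ Ideal.span {x}) := Ideal.Quotient.nontrivial_iff.mpr fun h ↦
    hx (Ideal.span_singleton_eq_top.mp h)
  .of_surjective' _ Ideal.Quotient.mk_surjective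

/-- Irreducibility of all parameter ideals passes to the quotient by a parameter avoiding the minimal
primes. -/
theorem ParameterIdealsIrreducible.quotient_span_singleton {R : Type*} [CommRing R]
    [IsNoetherianRing R] [IsLocalRing R] (h : ParameterIdealsIrreducible R) {x : R}
    (hn : ∀ p ∈ minimalPrimes R, x ∉ p) (hx : x ∈ maximalIdeal R)
    [IsLocalRing (R ⧸ Ideal.span {x})] : ParameterIdealsIrreducible (R ⧸ Ideal.span {x}) :=
  h.of_surjective Ideal.Quotient.mk_surjective hx Ideal.mk_ker
    (ringKrullDim_quotient_span_singleton_succ_eq_of_notMem_minimalPrimes hn hx)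

theorem isParameterIdeal_bot {R : Type*} [CommRing R] [IsLocalRing R] (hd : ringKrullDim R = 0) :
    IsParameterIdeal R ⊥ := by
  refine ⟨0, Fin.elim0, by simpa using hd, fun i ↦ i.elim0, by simp, ?_⟩
  have : Ring.KrullDimLE 0 R := Ring.krullDimLE_iff.mpr hd.le
  refine le_antisymm (le_maximalIdeal ?_) ?_
  · simp [Ideal.radical_eq_top]
  · rw [Ideal.radical_eq_sInf]
    refine le_sInf fun J hJ ↦ ?_
    have := hJ.2
    exact (eq_maximalIdeal (Ideal.isMaximal_of_isPrime J)).ge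

theorem IsLocalRing.exists_mem_maximalIdeal_notMem_of_finite {R : Type*} [CommRing R]
    [IsLocalRing R] {s : Set (Ideal R)} (hs : s.Finite) (hp : ∀ p ∈ s, p.IsPrime)
    (hm : maximalIdeal R ∉ s) : ∃ x ∈ maximalIdeal R, ∀ p ∈ s, x ∉ p := by
  by_contra! hx
  obtain ⟨p, hps, hle⟩ := (Ideal.subset_union_prime_finite (f := id) (I := maximalIdeal R)
    hs ⊥ ⊥ fun p hps _ _ ↦ hp p hps).mp (fun x h ↦ by simpa using hx x h)
  have := hp p hps
  exact hm (((maximalIdeal.isMaximal R).eq_of_le this.ne_top hle) ▸ hps)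

theorem IsLocalRing.exists_mem_maximalIdeal_forall_notMem_minimalPrimes {R : Type*} [CommRing R]
    [IsNoetherianRing R] [IsLocalRing R] (hd : ringKrullDim R ≠ 0) :
    ∃ x ∈ maximalIdeal R, ∀ p ∈ minimalPrimes R, x ∉ p := by
  refine exists_mem_maximalIdeal_notMem_of_finite (minimalPrimes.finite_of_isNoetherianRing R)
    (fun p hp ↦ hp.1.1) fun hm ↦ hd ?_
  rw [← maximalIdeal_height_eq_ringKrullDim, Ideal.height_eq_zero_iff.mpr hm]
  rfl

theorem IsLocalRing.exists_notMem_span_singleton_pow {R : Type*} [CommRing R]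
    [IsNoetherianRing R] [IsLocalRing R] {x s : R} (hx : x ∈ maximalIdeal R) (hs : s ≠ 0) :
    ∃ n ≠ 0, s ∉ Ideal.span {x ^ n} := by
  by_contra! h
  refine hs ?_
  have hbot := Ideal.iInf_pow_eq_bot_of_isLocalRing (Ideal.span {x})
    (fun h ↦ hx (Ideal.span_singleton_eq_top.mp h))
  rw [← Ideal.mem_bot, ← hbot, Ideal.mem_iInf]
  intro n
  rw [Ideal.span_singleton_pow]
  rcases eq_or_ne n 0 with rfl | hn
  · simp
  · exact h n hn

theorem IsIrreducibleIdeal.mem_span_singleton_of_sq {R : Type*} [CommRing R]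
    [IsLocalRing R] {y s : R} (h : IsIrreducibleIdeal (Ideal.span {y ^ 2}))
    (hy : y ∈ maximalIdeal R) (hs : ∀ a ∈ maximalIdeal R, a * s = 0)
    (hy0 : y ≠ 0) : s ∈ Ideal.span {y} := by
  by_contra hsy
  have hinf : Ideal.span {y ^ 2} = Ideal.span {y} ⊓ Ideal.span {s, y ^ 2} := by
    refine le_antisymm (le_inf ?_ ?_) ?_
    · exact Ideal.span_singleton_le_span_singleton.mpr (dvd_pow_self y two_ne_zero)
    · exact Ideal.span_mono (by simp)
    · rintro _ ⟨hzy, hz⟩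
      obtain ⟨r, t, rfl⟩ := Ideal.mem_span_pair.mp hz
      by_cases hr : IsUnit r
      · refine absurd ?_ hsy
        rw [← Ideal.unit_mul_mem_iff_mem _ hr]
        refine (Ideal.add_mem_iff_left _ ?_).mp hzy
        exact Ideal.mem_span_singleton.mpr ((dvd_pow_self y two_ne_zero).mul_left t)
      · rw [hs r hr, zero_add]
        exact Ideal.mul_mem_left _ _ (Ideal.mem_span_singleton_self _)
  rcases h.2 _ _ hinf with h | h
  · have : y ∈ Ideal.span {y ^ 2} := h ▸ Ideal.mem_span_singleton_self y
    obtain ⟨r, hr⟩ := Ideal.mem_span_singleton'.mp this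
    have hu : IsUnit (1 - r * y) := by
      by_contra hu
      exact (Ideal.ne_top_iff_one _).mp (maximalIdeal.isMaximal R).ne_top
        ((sub_add_cancel 1 (r * y)) ▸ add_mem hu (Ideal.mul_mem_left _ r hy))
    exact hy0 (hu.mul_right_eq_zero.mp (by linear_combination -hr))
  · refine hsy ?_
    have : s ∈ Ideal.span {y ^ 2} := h ▸ Ideal.subset_span (by simp)
    exact Ideal.span_singleton_le_span_singleton.mpr (dvd_pow_self y two_ne_zero) this

theorem ringKrullDim_eq_of_succ_eq {S : Type*} [CommRing S] {d : ℕ}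
    (h : ringKrullDim S + 1 = (d + 1 : ℕ)) : ringKrullDim S = d :=
  ENat.WithBot.add_one_cancel.mp (h.trans (by push_cast; rfl))

/-- In positive dimension, if all parameter ideals are irreducible then the socle vanishes. -/
theorem ParameterIdealsIrreducible.eq_zero_of_forall_mul_eq_zero (d : ℕ) {R : Type*} [CommRing R]
    [IsNoetherianRing R] [IsLocalRing R] (h : ParameterIdealsIrreducible R)
    (hd : ringKrullDim R = (d + 1 : ℕ)) {s : R} (hs : ∀ a ∈ maximalIdeal R, a * s = 0) :
    s = 0 := by
  induction d generalizing R with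
  | zero =>
    by_contra hs0
    obtain ⟨x, hx, hxp⟩ := exists_mem_maximalIdeal_forall_notMem_minimalPrimes (R := R)
      (by simp [hd])
    obtain ⟨n, hn, hsn⟩ := exists_notMem_span_singleton_pow hx hs0
    have hmem : (x ^ n) ^ 2 ∈ maximalIdeal R :=
      Ideal.pow_mem_of_mem _ (Ideal.pow_mem_of_mem _ hx n hn.bot_lt) 2 two_pos
    have hpow (k) (p) (hp : p ∈ minimalPrimes R) : (x ^ n) ^ k ∉ p := fun hk ↦
      hxp p hp (hp.1.1.mem_of_pow_mem n (hp.1.1.mem_of_pow_mem k hk))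
    have := isLocalRing_quotient_span_singleton hmem
    have hdim := ringKrullDim_quotient_span_singleton_succ_eq_of_notMem_minimalPrimes
      (hpow 2) hmem
    have hpar := (isParameterIdeal_bot (ringKrullDim_eq_of_succ_eq (d := 0) (hdim.trans hd))).comap
      Ideal.Quotient.mk_surjective hmem Ideal.mk_ker hdim
    rw [← RingHom.ker_eq_comap_bot, Ideal.mk_ker] at hpar
    refine hsn ((h _ hpar).mem_span_singleton_of_sq (Ideal.pow_mem_of_mem _ hx n hn.bot_lt) hs ?_)
    intro h0
    obtain ⟨p, hp⟩ := Ideal.nonempty_minimalPrimes (bot_ne_top (α := Ideal R))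
    exact hpow 1 p hp (by simp [h0])
  | succ d ih =>
    by_contra hs0
    obtain ⟨x, hx, hxp⟩ := exists_mem_maximalIdeal_forall_notMem_minimalPrimes (R := R)
      (by rw [hd]; exact_mod_cast Nat.succ_ne_zero (d + 1))
    obtain ⟨n, hn, hsn⟩ := exists_notMem_span_singleton_pow hx hs0
    have hmem : x ^ n ∈ maximalIdeal R := Ideal.pow_mem_of_mem _ hx n hn.bot_lt
    have hpow (p) (hp : p ∈ minimalPrimes R) : x ^ n ∉ p := fun hk ↦
      hxp p hp (hp.1.1.mem_of_pow_mem n hk)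
    have := isLocalRing_quotient_span_singleton hmem
    have hdim := ringKrullDim_quotient_span_singleton_succ_eq_of_notMem_minimalPrimes hpow hmem
    refine hsn (Ideal.Quotient.eq_zero_iff_mem.mp
      (ih (h.quotient_span_singleton hpow hmem) ?_ fun a ha ↦ ?_))
    · exact ringKrullDim_eq_of_succ_eq (hdim.trans hd)
    · obtain ⟨a, rfl⟩ := Ideal.Quotient.mk_surjective a
      have := IsLocalHom.of_surjective (Ideal.Quotient.mk (Ideal.span {x ^ n}))
        Ideal.Quotient.mk_surjective
      rw [← map_mul, hs a, map_zero]
      rwa [← IsLocalRing.maximalIdeal_comap (Ideal.Quotient.mk (Ideal.span {x ^ n}))]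

theorem ParameterIdealsIrreducible.exists_isSMulRegular {R : Type*} [CommRing R]
    [IsNoetherianRing R] [IsLocalRing R] (h : ParameterIdealsIrreducible R) {d : ℕ}
    (hd : ringKrullDim R = (d + 1 : ℕ)) : ∃ x ∈ maximalIdeal R, IsSMulRegular R x := by
  obtain ⟨x, hx, hxp⟩ := exists_mem_maximalIdeal_notMem_of_finite (associatedPrimes.finite R R)
    (fun p hp ↦ hp.isPrime) fun hm ↦ by
      obtain ⟨hp, s, hs⟩ := isAssociatedPrime_iff.mp hm
      have hs0 : s = 0 := h.eq_zero_of_forall_mul_eq_zero d hd fun a ha ↦ by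
        simpa [Submodule.mem_colon_singleton] using hs.le ha
      exact hp.ne_top (by simp [hs, hs0])
  refine ⟨x, hx, ?_⟩
  by_contra hreg
  have : x ∈ ⋃ p ∈ associatedPrimes R R, (p : Set R) := by
    rw [biUnion_associatedPrimes_eq_compl_regular]
    exact hreg
  simp only [Set.mem_iUnion] at this
  obtain ⟨p, hp, hxp'⟩ := this
  exact hxp p hp hxp'

open CategoryTheory in
theorem ParameterIdealsIrreducible.exists_hasInjectiveDimensionLE (d : ℕ) {R : Type u} [CommRing R]
    [IsNoetherianRing R] [IsLocalRing R] (h : ParameterIdealsIrreducible R)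
    (hd : ringKrullDim R = d) : ∃ n, HasInjectiveDimensionLE (ModuleCat.of R R) n := by
  induction d generalizing R with
  | zero =>
    have : IsArtinianRing R := isArtinianRing_iff_isNoetherianRing_krullDimLE_zero.mpr
      ⟨inferInstance, Ring.krullDimLE_iff.mpr hd.le⟩
    have := (h _ (isParameterIdeal_bot hd)).injective_self
    exact ⟨0, injective_iff_hasInjectiveDimensionLT_one.mp
      (Module.injective_object_of_injective_module R R)⟩
  | succ d ih =>
    obtain ⟨x, hx, hreg⟩ := h.exists_isSMulRegular hd
    have := isLocalRing_quotient_span_singleton hx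
    have hdim := ringKrullDim_quotient_span_singleton_succ_eq_ringKrullDim hreg hx
    obtain ⟨n, _⟩ := ih (h.of_surjective Ideal.Quotient.mk_surjective hx Ideal.mk_ker hdim)
      (ringKrullDim_eq_of_succ_eq (hdim.trans hd))
    exact ⟨n + 1, ModuleCat.hasInjectiveDimensionLE_of_quotient_span_singleton hreg hx n⟩

theorem gorenstein_of_parameter_ideals_irreducible (R : Type*) [CommRing R] [IsNoetherianRing R] [IsLocalRing R]
    (h : ∀ I : Ideal R, IsParameterIdeal R I → IsIrreducibleIdeal I) :
    HasFiniteInjectiveDimension R := by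
  obtain ⟨d, hd⟩ : ∃ d : ℕ, ringKrullDim R = d := by
    obtain ⟨d, hd⟩ := ENat.ne_top_iff_exists.mp
      (Ideal.height_ne_top (maximalIdeal.isMaximal R).ne_top)
    exact ⟨d, by rw [← maximalIdeal_height_eq_ringKrullDim, ← hd]; rfl⟩
  obtain ⟨n, _⟩ := ParameterIdealsIrreducible.exists_hasInjectiveDimensionLE d h hd
  exact ⟨n, CategoryTheory.exists_injectiveResolution_isZero_of_hasInjectiveDimensionLE n _⟩
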